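/- Let a, L > 0. There exist constants c > 0 and ℓ₀ > 0, depending only on a and L, with the following property. For every ℓ ∈ (0, ℓ₀] and every Lipschitz continuous ρ : Q^ℓ = [0, ℓ]² → ℝ with Lipschitz constant at most L and ρ ≥ a, define r(x) = ρ(x)/∫_{Q^ℓ} ρ, r₂(x₂) = ∫_0^ℓ r(x₁', x₂) dx₁', and G : Q^ℓ → ℝ² by G₁(x₁, x₂) = ℓ · (1/r₂(x₂)) ∫_0^{x₁} r(x₁', x₂) dx₁' and G₂(x₁, x₂) = ℓ · ∫_0^{x₂} r₂(x₂') dx₂'. Then for all x, y ∈ Q^ℓ, |G(x) − G(y)|² ≥ (1 − cℓ) |x − y|², and consequently the inverse map Γ = G^{-1} satisfies |Γ(u) − Γ(v)|² ≤ (1 + cℓ) |u − v|² for all u, v in the image of G. -/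

import Mathlib

open MeasureTheory Filter
open scoped ENNReal NNReal Topology

noncomputable section

/-- The plane, with the Euclidean norm. -/
abbrev E2 : Type := EuclideanSpace ℝ (Fin 2)

/-- The point of `ℝ²` with coordinates `(s, t)`. -/
def mk2 (s t : ℝ) : E2 := (WithLp.equiv 2 (Fin 2 → ℝ)).symm ![s, t]

/-- The square `Q^ℓ = [0,ℓ]²`. -/
def sqSet (ℓ : ℝ) : Set E2 := {x | ∀ i, x i ∈ Set.Icc (0 : ℝ) ℓ}

/-- Elementary: `X ≥ P - S` gives `X² ≥ P² - 2PS`. -/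
lemma sq_lower (X P S : ℝ) (hX : 0 ≤ X) (hP : 0 ≤ P) (hS : 0 ≤ S) (h : P - S ≤ X) :
    P ^ 2 - 2 * P * S ≤ X ^ 2 := by
  rcases le_total S P with h1 | h1
  · nlinarith [mul_self_le_mul_self (sub_nonneg.2 h1) h, sq_nonneg S]
  · nlinarith [mul_le_mul_of_nonneg_left h1 hP, sq_nonneg X, mul_nonneg hP hS]

lemma int_lower (g : ℝ → ℝ) (ℓ m p q : ℝ) (hg : ContinuousOn g (Set.Icc 0 ℓ))
    (hm : ∀ s ∈ Set.Icc (0:ℝ) ℓ, m ≤ g s)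
    (hp : p ∈ Set.Icc (0:ℝ) ℓ) (hq : q ∈ Set.Icc (0:ℝ) ℓ) :
    m * |p - q| ≤ |(∫ s in (0:ℝ)..p, g s) - ∫ s in (0:ℝ)..q, g s| := by
  have h0 : (0:ℝ) ∈ Set.Icc (0:ℝ) ℓ := ⟨le_rfl, hp.1.trans hp.2⟩
  have hi : ∀ x ∈ Set.Icc (0:ℝ) ℓ, ∀ y ∈ Set.Icc (0:ℝ) ℓ, IntervalIntegrable g volume x y :=
    fun x hx y hy => (hg.mono (Set.uIcc_subset_Icc hx hy)).intervalIntegrable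
  rw [intervalIntegral.integral_interval_sub_left (hi _ h0 _ hp) (hi _ h0 _ hq)]
  have key : ∀ x ∈ Set.Icc (0:ℝ) ℓ, ∀ y ∈ Set.Icc (0:ℝ) ℓ, x ≤ y →
      m * (y - x) ≤ ∫ s in x..y, g s := by
    intro x hx y hy hxy
    have := intervalIntegral.integral_mono_on hxy
      (intervalIntegrable_const (c := m) (μ := volume)) (hi _ hx _ hy)
      (fun s hs => hm s ⟨hx.1.trans hs.1, hs.2.trans hy.2⟩)
    rw [intervalIntegral.integral_const, smul_eq_mul] at this
    linarith
  rcases le_total q p with h | h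
  · rw [abs_of_nonneg (sub_nonneg.2 h)]
    exact (key q hq p hp h).trans (le_abs_self _)
  · rw [abs_sub_comm, abs_of_nonneg (sub_nonneg.2 h), intervalIntegral.integral_symm, abs_neg]
    exact (key p hp q hq h).trans (le_abs_self _)

lemma core (a L ℓ M b : ℝ) (ha : 0 < a) (hL : 0 < L) (hℓ : 0 < ℓ) (hs : 24 * L * ℓ ≤ a)
    (f : ℝ → ℝ → ℝ)
    (hf : ∀ s ∈ Set.Icc (0:ℝ) ℓ, ∀ t ∈ Set.Icc (0:ℝ) ℓ, ∀ s' ∈ Set.Icc (0:ℝ) ℓ,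
      ∀ t' ∈ Set.Icc (0:ℝ) ℓ, |f s t - f s' t'| ≤ L * (|s - s'| + |t - t'|))
    (hfa : ∀ s ∈ Set.Icc (0:ℝ) ℓ, ∀ t ∈ Set.Icc (0:ℝ) ℓ, a ≤ f s t)
    (hab : a ≤ b)
    (hfb : ∀ s ∈ Set.Icc (0:ℝ) ℓ, ∀ t ∈ Set.Icc (0:ℝ) ℓ, b - 2 * L * ℓ ≤ f s t ∧ f s t ≤ b + 2 * L * ℓ)
    (hM : 0 < M) (hM2 : M ≤ (b + 2 * L * ℓ) * ℓ ^ 2)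
    (R : ℝ → ℝ) (hR : R = fun t => ∫ s in (0:ℝ)..ℓ, f s t)
    (p t q u : ℝ) (hp : p ∈ Set.Icc (0:ℝ) ℓ) (ht : t ∈ Set.Icc (0:ℝ) ℓ)
    (hq : q ∈ Set.Icc (0:ℝ) ℓ) (hu : u ∈ Set.Icc (0:ℝ) ℓ) :
    (1 - 12 * L * ℓ / a) * ((p - q) ^ 2 + (t - u) ^ 2) ≤
      (ℓ * (R t)⁻¹ * (∫ s in (0:ℝ)..p, f s t) - ℓ * (R u)⁻¹ * (∫ s in (0:ℝ)..q, f s u)) ^ 2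
      + (ℓ * ((∫ s in (0:ℝ)..t, R s) / M) - ℓ * ((∫ s in (0:ℝ)..u, R s) / M)) ^ 2 := by
  have h0 : (0:ℝ) ∈ Set.Icc (0:ℝ) ℓ := ⟨le_rfl, hℓ.le⟩
  have hl : ℓ ∈ Set.Icc (0:ℝ) ℓ := ⟨hℓ.le, le_rfl⟩
  have hLl : 0 < L * ℓ := mul_pos hL hℓ
  obtain ⟨ε, hε⟩ : ∃ ε, ε = 4 * L * ℓ / a := ⟨_, rfl⟩
  have hεa : ε * a = 4 * L * ℓ := by rw [hε]; field_simp
  have hε0 : 0 < ε := by rw [hε]; positivity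
  have hε1 : ε ≤ 1 / 6 := by rw [hε, div_le_iff₀ ha]; linarith
  have hεb : 4 * L * ℓ ≤ ε * b := by rw [← hεa]; gcongr
  -- continuity in the first variable
  have hfc : ∀ t ∈ Set.Icc (0:ℝ) ℓ, ContinuousOn (fun s => f s t) (Set.Icc 0 ℓ) := by
    intro t ht
    have : LipschitzOnWith (Real.toNNReal L) (fun s => f s t) (Set.Icc 0 ℓ) := by
      refine LipschitzOnWith.of_dist_le_mul fun x hx y hy => ?_
      have := hf x hx t ht y hy t ht
      rw [Real.dist_eq, Real.dist_eq, Real.coe_toNNReal _ hL.le]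
      simpa using this
    exact this.continuousOn
  have hii : ∀ t ∈ Set.Icc (0:ℝ) ℓ, ∀ x ∈ Set.Icc (0:ℝ) ℓ, ∀ y ∈ Set.Icc (0:ℝ) ℓ,
      IntervalIntegrable (fun s => f s t) volume x y :=
    fun t ht x hx y hy => ((hfc t ht).mono (Set.uIcc_subset_Icc hx hy)).intervalIntegrable
  -- partial integrals: Lipschitz in the second variable
  have hF : ∀ p ∈ Set.Icc (0:ℝ) ℓ, ∀ t ∈ Set.Icc (0:ℝ) ℓ, ∀ u ∈ Set.Icc (0:ℝ) ℓ,
      |(∫ s in (0:ℝ)..p, f s t) - ∫ s in (0:ℝ)..p, f s u| ≤ L * ℓ * |t - u| := by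
    intro p hp t ht u hu
    rw [← intervalIntegral.integral_sub (hii t ht _ h0 _ hp) (hii u hu _ h0 _ hp)]
    have := intervalIntegral.norm_integral_le_of_norm_le_const (a := 0) (b := p)
      (f := fun s => f s t - f s u) (C := L * |t - u|) (by
        intro s hs
        rw [Set.uIoc_of_le hp.1] at hs
        have hs' : s ∈ Set.Icc (0:ℝ) ℓ := ⟨hs.1.le, hs.2.trans hp.2⟩
        simpa using hf s hs' t ht s hs' u hu)
    rw [Real.norm_eq_abs, sub_zero, abs_of_nonneg hp.1] at this
    refine this.trans ?_
    have : L * |t - u| * p ≤ L * |t - u| * ℓ := by gcongr; exact hp.2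
    linarith
  have hRl : ∀ t ∈ Set.Icc (0:ℝ) ℓ, ∀ u ∈ Set.Icc (0:ℝ) ℓ, |R t - R u| ≤ L * ℓ * |t - u| := by
    intro t ht u hu
    rw [hR]; exact hF ℓ hl t ht u hu
  have hRc : ContinuousOn R (Set.Icc 0 ℓ) := by
    have : LipschitzOnWith (Real.toNNReal (L * ℓ)) R (Set.Icc 0 ℓ) := by
      refine LipschitzOnWith.of_dist_le_mul fun x hx y hy => ?_
      rw [Real.dist_eq, Real.dist_eq, Real.coe_toNNReal _ hLl.le]
      exact hRl x hx y hy
    exact this.continuousOn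
  have hRlow : ∀ c, (∀ s ∈ Set.Icc (0:ℝ) ℓ, ∀ t ∈ Set.Icc (0:ℝ) ℓ, c ≤ f s t) →
      ∀ t ∈ Set.Icc (0:ℝ) ℓ, c * ℓ ≤ R t := by
    intro c hc t ht
    have := intervalIntegral.integral_mono_on hℓ.le
      (intervalIntegrable_const (c := c) (μ := volume)) (hii t ht _ h0 _ hl)
      (fun s hs => hc s hs t ht)
    rw [intervalIntegral.integral_const, smul_eq_mul] at this
    rw [hR]; simp only; linarith
  have hRup : ∀ t ∈ Set.Icc (0:ℝ) ℓ, R t ≤ (b + 2 * L * ℓ) * ℓ := by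
    intro t ht
    have := intervalIntegral.integral_mono_on hℓ.le (hii t ht _ h0 _ hl)
      (intervalIntegrable_const (c := b + 2 * L * ℓ) (μ := volume))
      (fun s hs => (hfb s hs t ht).2)
    rw [intervalIntegral.integral_const, smul_eq_mul] at this
    rw [hR]; simp only; linarith
  have hRa := hRlow a hfa
  have hRb := hRlow _ (fun s hs t ht => (hfb s hs t ht).1)
  have hRpos : ∀ t ∈ Set.Icc (0:ℝ) ℓ, 0 < R t := fun t ht => (mul_pos ha hℓ).trans_le (hRa t ht)
  have hrat : (1 - ε) * (b + 2 * L * ℓ) ≤ b - 2 * L * ℓ := by nlinarith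
  -- second component
  have hB : (1 - ε) * |t - u| ≤
      |ℓ * ((∫ s in (0:ℝ)..t, R s) / M) - ℓ * ((∫ s in (0:ℝ)..u, R s) / M)| := by
    have h1 := int_lower R ℓ ((b - 2 * L * ℓ) * ℓ) t u hRc hRb ht hu
    have e : ℓ * ((∫ s in (0:ℝ)..t, R s) / M) - ℓ * ((∫ s in (0:ℝ)..u, R s) / M)
        = ℓ / M * ((∫ s in (0:ℝ)..t, R s) - ∫ s in (0:ℝ)..u, R s) := by ring
    rw [e, abs_mul, abs_of_pos (div_pos hℓ hM)]
    rw [div_mul_eq_mul_div, le_div_iff₀ hM]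
    calc (1 - ε) * |t - u| * M ≤ (1 - ε) * |t - u| * ((b + 2 * L * ℓ) * ℓ ^ 2) := by
          have : 0 ≤ 1 - ε := by linarith
          gcongr
      _ = ((1 - ε) * (b + 2 * L * ℓ)) * (|t - u| * ℓ ^ 2) := by ring
      _ ≤ (b - 2 * L * ℓ) * (|t - u| * ℓ ^ 2) := by gcongr
      _ = ℓ * ((b - 2 * L * ℓ) * ℓ * |t - u|) := by ring
      _ ≤ _ := by gcongr
  -- first component, variation in the first variable
  have hA1 : (1 - ε) * |p - q| ≤
      |ℓ * (R t)⁻¹ * ((∫ s in (0:ℝ)..p, f s t) - ∫ s in (0:ℝ)..q, f s t)| := by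
    have h1 := int_lower (fun s => f s t) ℓ (b - 2 * L * ℓ) p q (hfc t ht)
      (fun s hs => (hfb s hs t ht).1) hp hq
    have hRt := hRpos t ht
    rw [abs_mul, abs_of_pos (mul_pos hℓ (inv_pos.2 hRt)), ← div_eq_mul_inv,
      div_mul_eq_mul_div, le_div_iff₀ hRt]
    calc (1 - ε) * |p - q| * R t ≤ (1 - ε) * |p - q| * ((b + 2 * L * ℓ) * ℓ) := by
          have : 0 ≤ 1 - ε := by linarith
          gcongr
          exact hRup t ht
      _ = ((1 - ε) * (b + 2 * L * ℓ)) * (|p - q| * ℓ) := by ring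
      _ ≤ (b - 2 * L * ℓ) * (|p - q| * ℓ) := by gcongr
      _ = ℓ * ((b - 2 * L * ℓ) * |p - q|) := by ring
      _ ≤ _ := by gcongr
  -- first component, variation in the second variable
  have hA2 : |ℓ * (R t)⁻¹ * (∫ s in (0:ℝ)..q, f s t) - ℓ * (R u)⁻¹ * ∫ s in (0:ℝ)..q, f s u|
      ≤ ε * |t - u| := by
    have hRt := hRpos t ht
    have hRu := hRpos u hu
    have hd := hF q hq t ht u hu
    have hr := hRl t ht u hu
    have hFu0 : 0 ≤ ∫ s in (0:ℝ)..q, f s u := intervalIntegral.integral_nonneg hq.1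
      (fun s hs => ha.le.trans (hfa s ⟨hs.1, hs.2.trans hq.2⟩ u hu))
    have hFu1 : (∫ s in (0:ℝ)..q, f s u) ≤ R u := by
      have h2 : 0 ≤ ∫ s in q..ℓ, f s u := intervalIntegral.integral_nonneg hq.2
        (fun s hs => ha.le.trans (hfa s ⟨hq.1.trans hs.1, hs.2⟩ u hu))
      have h3 := intervalIntegral.integral_add_adjacent_intervals
        (hii u hu _ h0 _ hq) (hii u hu _ hq _ hl)
      rw [hR]; simp only; linarith
    generalize (∫ s in (0:ℝ)..q, f s t) = A at *
    generalize (∫ s in (0:ℝ)..q, f s u) = B at *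
    have e : ℓ * (R t)⁻¹ * A - ℓ * (R u)⁻¹ * B
        = ℓ / R t * ((A - B) - B / R u * (R t - R u)) := by
      field_simp
      ring
    have hBR : B / R u ≤ 1 := (div_le_one hRu).2 hFu1
    have hBR0 : 0 ≤ B / R u := by positivity
    rw [e, abs_mul, abs_of_pos (div_pos hℓ hRt), div_mul_eq_mul_div, div_le_iff₀ hRt]
    have h5 : |(A - B) - B / R u * (R t - R u)| ≤ 2 * (L * ℓ * |t - u|) := by
      refine (abs_sub _ _).trans ?_
      rw [abs_mul, abs_of_nonneg hBR0]
      have : B / R u * |R t - R u| ≤ 1 * (L * ℓ * |t - u|) := by gcongr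
      linarith
    calc ℓ * |(A - B) - B / R u * (R t - R u)| ≤ ℓ * (2 * (L * ℓ * |t - u|)) := by gcongr
      _ ≤ ℓ * (4 * L * ℓ * |t - u|) := by
        have : 0 ≤ L * ℓ * |t - u| := by positivity
        exact mul_le_mul_of_nonneg_left (by linarith) hℓ.le
      _ = ε * |t - u| * (a * ℓ) := by rw [← hεa]; ring
      _ ≤ _ := by
        have := hRa t ht
        gcongr
  have hA : (1 - ε) * |p - q| - ε * |t - u| ≤
      |ℓ * (R t)⁻¹ * (∫ s in (0:ℝ)..p, f s t) - ℓ * (R u)⁻¹ * (∫ s in (0:ℝ)..q, f s u)| := by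
    generalize (∫ s in (0:ℝ)..q, f s t) = A at *
    generalize (∫ s in (0:ℝ)..q, f s u) = B at *
    generalize (∫ s in (0:ℝ)..p, f s t) = D at *
    have e : ℓ * (R t)⁻¹ * (D - A) =
      (ℓ * (R t)⁻¹ * D - ℓ * (R u)⁻¹ * B) - (ℓ * (R t)⁻¹ * A - ℓ * (R u)⁻¹ * B) := by ring
    rw [e] at hA1
    have := abs_sub (ℓ * (R t)⁻¹ * D - ℓ * (R u)⁻¹ * B) (ℓ * (R t)⁻¹ * A - ℓ * (R u)⁻¹ * B)
    linarith
  have e1 : 12 * L * ℓ / a = 3 * ε := by rw [hε]; ring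
  rw [e1, ← sq_abs (p - q), ← sq_abs (t - u), ← sq_abs (_ - ℓ * (R u)⁻¹ * _),
    ← sq_abs (ℓ * _ - ℓ * (_ / M))]
  have hX := abs_nonneg (p - q)
  have hY := abs_nonneg (t - u)
  have h1ε : 0 ≤ 1 - ε := by linarith
  have k1 := sq_lower _ _ _ (abs_nonneg _) (mul_nonneg h1ε hX) (mul_nonneg hε0.le hY) hA
  have k2 := pow_le_pow_left₀ (mul_nonneg h1ε hY) hB 2
  refine le_trans ?_ (add_le_add k1 k2)
  generalize |p - q| = X at *
  generalize |t - u| = Y at *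
  have k3 : 0 ≤ ε * (X - Y) ^ 2 := by positivity
  have k4 : 0 ≤ ε ^ 2 * (X * Y) := by positivity
  have k5 : 0 ≤ ε ^ 2 * (X ^ 2 + Y ^ 2) := by positivity
  nlinarith

lemma norm_sq_E2 (x : E2) : ‖x‖ ^ 2 = x 0 ^ 2 + x 1 ^ 2 := by
  rw [EuclideanSpace.norm_sq_eq, Fin.sum_univ_two]; simp

lemma mk2_mem {ℓ s t : ℝ} (hs : s ∈ Set.Icc (0:ℝ) ℓ) (ht : t ∈ Set.Icc (0:ℝ) ℓ) :
    mk2 s t ∈ sqSet ℓ := by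
  intro i
  fin_cases i
  · simpa [mk2] using hs
  · simpa [mk2] using ht

lemma sqSet_eq (ℓ : ℝ) : sqSet ℓ = (WithLp.ofLp : E2 → Fin 2 → ℝ) ⁻¹' (Set.pi Set.univ fun _ => Set.Icc (0:ℝ) ℓ) := by
  ext x; simp only [sqSet, Set.mem_setOf_eq, Set.mem_preimage, Set.mem_pi, Set.mem_univ, true_imp_iff]

lemma measurable_sqSet (ℓ : ℝ) : MeasurableSet (sqSet ℓ) := by
  rw [sqSet_eq]
  exact (PiLp.volume_preserving_ofLp (Fin 2)).measurable
    (MeasurableSet.univ_pi fun _ => measurableSet_Icc)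

lemma volume_sqSet (ℓ : ℝ) : volume (sqSet ℓ) = ENNReal.ofReal ℓ ^ 2 := by
  rw [sqSet_eq, (PiLp.volume_preserving_ofLp (Fin 2)).measure_preimage
    (MeasurableSet.univ_pi fun _ => measurableSet_Icc).nullMeasurableSet, volume_pi_pi]
  simp

/-- For `a, L > 0` there are `c, ℓ₀ > 0` such that for every `0 < ℓ ≤ ℓ₀` and
every `L`-Lipschitz density `ρ ≥ a` on `Q^ℓ = [0,ℓ]²`, the Knothe-type map `G`
built from the normalized density `r = ρ/∫ρ` satisfies
`|G(x) − G(y)|² ≥ (1 − cℓ)|x − y|²` on `Q^ℓ`; consequently any inverse `Γ` of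
`G` satisfies `|Γ(u) − Γ(v)|² ≤ (1 + cℓ)|u − v|²` on the image of `Q^ℓ`. -/
theorem transport_map_almost_isometry (a L : ℝ) (ha : 0 < a) (hL : 0 < L) :
    ∃ c > (0 : ℝ), ∃ ℓ₀ > (0 : ℝ), ∀ ℓ : ℝ, 0 < ℓ → ℓ ≤ ℓ₀ →
      ∀ ρ : E2 → ℝ, LipschitzOnWith (Real.toNNReal L) ρ (sqSet ℓ) →
        (∀ x ∈ sqSet ℓ, a ≤ ρ x) →
        ∀ r : E2 → ℝ, r = (fun x => ρ x / ∫ y in sqSet ℓ, ρ y) →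
        ∀ r₂ : ℝ → ℝ,
          r₂ = (fun x₂ => ∫ x₁' in Set.Icc (0 : ℝ) ℓ, r (mk2 x₁' x₂)) →
        ∀ G : E2 → E2,
          G = (fun x => mk2
            (ℓ * (r₂ (x 1))⁻¹ * ∫ s in (0 : ℝ)..(x 0), r (mk2 s (x 1)))
            (ℓ * ∫ t in (0 : ℝ)..(x 1), r₂ t)) →
        (∀ x ∈ sqSet ℓ, ∀ y ∈ sqSet ℓ,
          (1 - c * ℓ) * ‖x - y‖ ^ 2 ≤ ‖G x - G y‖ ^ 2) ∧
        (∀ Γ : E2 → E2, (∀ x ∈ sqSet ℓ, Γ (G x) = x) →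
          ∀ u ∈ G '' sqSet ℓ, ∀ v ∈ G '' sqSet ℓ,
            ‖Γ u - Γ v‖ ^ 2 ≤ (1 + c * ℓ) * ‖u - v‖ ^ 2) := by
  refine ⟨24 * L / a, by positivity, a / (24 * L), by positivity, ?_⟩
  intro ℓ hℓ hℓ0 ρ hρ hρa r hr r₂ hr₂ G hG
  have hs : 24 * L * ℓ ≤ a := by
    rw [le_div_iff₀ (by positivity)] at hℓ0; linarith
  have h0 : (0:ℝ) ∈ Set.Icc (0:ℝ) ℓ := ⟨le_rfl, hℓ.le⟩
  have hlip : ∀ x ∈ sqSet ℓ, ∀ y ∈ sqSet ℓ, |ρ x - ρ y| ≤ L * (|x 0 - y 0| + |x 1 - y 1|) := by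
    intro x hx y hy
    have h1 := hρ.dist_le_mul x hx y hy
    rw [Real.dist_eq, Real.coe_toNNReal _ hL.le, dist_eq_norm] at h1
    refine h1.trans ?_
    gcongr
    refine abs_le_of_sq_le_sq' ?_ (by positivity) |>.2
    rw [norm_sq_E2]
    have : 0 ≤ |x 0 - y 0| * |x 1 - y 1| := by positivity
    simp only [PiLp.sub_apply]
    rw [← sq_abs (x 0 - y 0), ← sq_abs (x 1 - y 1)]
    nlinarith
  obtain ⟨b, hb⟩ : ∃ b, b = ρ (mk2 0 0) := ⟨_, rfl⟩
  have hz := mk2_mem h0 h0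
  have hab : a ≤ b := by rw [hb]; exact hρa _ hz
  have hρb : ∀ x ∈ sqSet ℓ, b - 2 * L * ℓ ≤ ρ x ∧ ρ x ≤ b + 2 * L * ℓ := by
    intro x hx
    have h1 := hlip x hx _ hz
    rw [← hb] at h1
    have e0 : |x 0 - (mk2 0 0) 0| ≤ ℓ := by
      simp only [mk2]; simpa using abs_le.2 ⟨by linarith [(hx 0).1], (hx 0).2⟩
    have e1 : |x 1 - (mk2 0 0) 1| ≤ ℓ := by
      simp only [mk2]; simpa using abs_le.2 ⟨by linarith [(hx 1).1], (hx 1).2⟩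
    have h2 : |ρ x - b| ≤ L * (ℓ + ℓ) := h1.trans (by gcongr)
    rw [abs_le] at h2
    constructor <;> linarith [h2.1, h2.2]
  obtain ⟨M, hMd⟩ : ∃ M, M = ∫ y in sqSet ℓ, ρ y := ⟨_, rfl⟩
  rw [← hMd] at hr
  have hvol : volume.real (sqSet ℓ) = ℓ ^ 2 := by
    rw [Measure.real, volume_sqSet]; simp [hℓ.le]
  have hvt : volume (sqSet ℓ) ≠ ⊤ := by rw [volume_sqSet]; finiteness
  have hint : IntegrableOn ρ (sqSet ℓ) := by
    refine IntegrableOn.of_bound (C := b + 2 * L * ℓ) (lt_top_iff_ne_top.2 hvt) ?_ ?_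
    · exact hρ.continuousOn.aestronglyMeasurable (measurable_sqSet ℓ)
    · refine (ae_restrict_iff' (measurable_sqSet ℓ)).2 (Eventually.of_forall fun x hx => ?_)
      rw [Real.norm_eq_abs, abs_of_nonneg (ha.le.trans (hρa x hx))]
      exact (hρb x hx).2
  have hcI : ∀ k : ℝ, ∫ y in sqSet ℓ, k = k * ℓ ^ 2 := by
    intro k; rw [setIntegral_const, hvol, smul_eq_mul, mul_comm]
  have hM : 0 < M := by
    have : a * ℓ ^ 2 ≤ M := by
      rw [hMd, ← hcI]
      exact setIntegral_mono_on (integrableOn_const hvt) hint (measurable_sqSet ℓ) hρa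
    exact lt_of_lt_of_le (by positivity) this
  have hM2 : M ≤ (b + 2 * L * ℓ) * ℓ ^ 2 := by
    rw [hMd, ← hcI]
    exact setIntegral_mono_on hint (integrableOn_const hvt) (measurable_sqSet ℓ)
      fun x hx => (hρb x hx).2
  obtain ⟨R, hR⟩ : ∃ R : ℝ → ℝ, R = fun t => ∫ s in (0:ℝ)..ℓ, ρ (mk2 s t) := ⟨_, rfl⟩
  have hr₂' : r₂ = fun t => R t / M := by
    rw [hr₂, hR, hr]
    funext t
    rw [integral_Icc_eq_integral_Ioc, ← intervalIntegral.integral_of_le hℓ.le,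
      intervalIntegral.integral_div]
  have hG' : G = fun x => mk2 (ℓ * (R (x 1))⁻¹ * ∫ s in (0:ℝ)..(x 0), ρ (mk2 s (x 1)))
      (ℓ * ((∫ t in (0:ℝ)..(x 1), R t) / M)) := by
    rw [hG, hr₂', hr]
    funext x
    simp only [intervalIntegral.integral_div]
    congr 1
    rw [inv_div]
    field_simp
  have main : ∀ x ∈ sqSet ℓ, ∀ y ∈ sqSet ℓ,
      (1 - 12 * L * ℓ / a) * ‖x - y‖ ^ 2 ≤ ‖G x - G y‖ ^ 2 := by
    intro x hx y hy
    have := core a L ℓ M b ha hL hℓ hs (fun s t => ρ (mk2 s t))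
      (fun s hs t ht s' hs' t' ht' => by
        simpa [mk2] using hlip _ (mk2_mem hs ht) _ (mk2_mem hs' ht'))
      (fun s hs t ht => hρa _ (mk2_mem hs ht)) hab
      (fun s hs t ht => hρb _ (mk2_mem hs ht)) hM hM2 R hR
      (x 0) (x 1) (y 0) (y 1) (hx 0) (hx 1) (hy 0) (hy 1)
    rw [norm_sq_E2, norm_sq_E2, hG']
    exact this
  obtain ⟨d, hd⟩ : ∃ d, d = 12 * L * ℓ / a := ⟨_, rfl⟩
  have hd0 : 0 < d := by rw [hd]; positivity
  have hd1 : d ≤ 1 / 2 := by rw [hd, div_le_iff₀ ha]; linarith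
  have hcd : 24 * L / a * ℓ = 2 * d := by rw [hd]; ring
  rw [hcd]
  rw [← hd] at main
  constructor
  · intro x hx y hy
    refine le_trans ?_ (main x hx y hy)
    gcongr
    linarith
  · rintro Γ hΓ _ ⟨x, hx, rfl⟩ _ ⟨y, hy, rfl⟩
    rw [hΓ x hx, hΓ y hy]
    have h1 := mul_le_mul_of_nonneg_left (main x hx y hy) (by linarith : 0 ≤ 1 + 2 * d)
    refine le_trans ?_ h1
    have : 1 ≤ (1 + 2 * d) * (1 - d) := by nlinarith
    nlinarith [mul_le_mul_of_nonneg_right this (sq_nonneg ‖x - y‖)]
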